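/- arXiv:1605.06892 — 2 statements merged into one kernel-verified Lean document; each statement's English description precedes it below -/
import Mathlib

section
/- Let E be a finite-dimensional real inner product space, n ≥ 1, and f₁, ..., fₙ : E → ℝ convex differentiable functions, each Lᵢ-smooth with Lᵢ > 0, and F = (1/n)∑ᵢ fᵢ. Let q₁, ..., qₙ be strictly positive reals with ∑ᵢ qᵢ = 1 and set L_Q = maxᵢ Lᵢ/(qᵢ n). Then for all y, x̃ ∈ E, (1/(2 L_Q)) ∑ᵢ qᵢ (1/(n qᵢ))² ‖∇fᵢ(y) − ∇fᵢ(x̃)‖² + ⟨∇F(y), x̃ − y⟩ ≤ F(x̃) − F(y). -/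
open RealInnerProductSpace

section Smooth

variable {E : Type*} [NormedAddCommGroup E] [InnerProductSpace ℝ E] [CompleteSpace E]
  {f : E → ℝ} {f' : E → E} {L : ℝ}

lemma HasGradientAt.hasDerivAt_comp_add_smul {g x v : E} {t : ℝ}
    (h : HasGradientAt f g (x + t • v)) :
    HasDerivAt (fun s : ℝ => f (x + s • v)) ⟪g, v⟫ t := by
  have hline : HasDerivAt (fun s : ℝ => x + s • v) v t := by
    simpa using ((hasDerivAt_id t).smul_const v).const_add x
  simpa [Function.comp_def] using
    (hasGradientAt_iff_hasFDerivAt.mp h).comp_hasDerivAt t hline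

/-- A differentiable convex function lies above its tangent hyperplanes. -/
lemma ConvexOn.add_inner_gradient_le {g x : E} (hf : ConvexOn ℝ Set.univ f)
    (hg : HasGradientAt f g x) (y : E) : f x + ⟪g, y - x⟫ ≤ f y := by
  have hconv : ConvexOn ℝ Set.univ (fun s : ℝ => f (x + s • (y - x))) := by
    have := hf.comp_affineMap (AffineMap.lineMap (k := ℝ) x y)
    simpa [Function.comp_def, AffineMap.lineMap_apply, add_comm] using this
  have hderiv : HasDerivAt (fun s : ℝ => f (x + s • (y - x))) ⟪g, y - x⟫ 0 :=
    HasGradientAt.hasDerivAt_comp_add_smul (by simpa using hg)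
  have := hconv.le_slope_of_hasDerivAt (Set.mem_univ 0) (Set.mem_univ 1) one_pos hderiv
  simp [slope_def_field] at this
  linarith

/-- The descent lemma: a function with `L`-Lipschitz gradient is bounded above by its
first-order expansion plus `L / 2` times the squared distance. -/
lemma le_add_inner_gradient_add_norm_sq (hf : ∀ x, HasGradientAt f (f' x) x)
    (hL : ∀ x y, ‖f' x - f' y‖ ≤ L * ‖x - y‖) (x v : E) :
    f (x + v) ≤ f x + ⟪f' x, v⟫ + L / 2 * ‖v‖ ^ 2 := by
  have hderiv (t : ℝ) : HasDerivAt
      (fun s : ℝ => f (x + s • v) - s * ⟪f' x, v⟫ - s ^ 2 * (L / 2 * ‖v‖ ^ 2))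
      (⟪f' (x + t • v), v⟫ - ⟪f' x, v⟫ - 2 * t * (L / 2 * ‖v‖ ^ 2)) t := by
    have h₁ := (hf (x + t • v)).hasDerivAt_comp_add_smul
    have h₂ := (hasDerivAt_id t).mul_const ⟪f' x, v⟫
    have h₃ := (hasDerivAt_pow 2 t).mul_const (L / 2 * ‖v‖ ^ 2)
    simpa using (h₁.fun_sub h₂).fun_sub h₃
  have hanti := antitoneOn_of_deriv_nonpos (convex_Icc (0 : ℝ) 1)
    (fun t _ => (hderiv t).continuousAt.continuousWithinAt)
    (fun t _ => (hderiv t).differentiableAt.differentiableWithinAt)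
    (fun t ht => by
      rw [interior_Icc] at ht
      rw [(hderiv t).deriv, ← inner_sub_left]
      have h₁ := real_inner_le_norm (f' (x + t • v) - f' x) v
      have h₂ := hL (x + t • v) x
      rw [add_sub_cancel_left, norm_smul, Real.norm_of_nonneg ht.1.le] at h₂
      nlinarith [mul_le_mul_of_nonneg_right h₂ (norm_nonneg v)])
  have := hanti (Set.left_mem_Icc.2 zero_le_one) (Set.right_mem_Icc.2 zero_le_one) zero_le_one
  simp at this
  linarith

lemma ConvexOn.norm_sub_gradient_sq_le (hLpos : 0 < L) (hconv : ConvexOn ℝ Set.univ f)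
    (hf : ∀ x, HasGradientAt f (f' x) x)
    (hL : ∀ x y, ‖f' x - f' y‖ ≤ L * ‖x - y‖) (y x : E) :
    1 / (2 * L) * ‖f' y - f' x‖ ^ 2 + ⟪f' y, x - y⟫ ≤ f x - f y := by
  have h₁ := le_add_inner_gradient_add_norm_sq hf hL x ((1 / L) • (f' y - f' x))
  have h₂ := hconv.add_inner_gradient_le (hf y) (x + (1 / L) • (f' y - f' x))
  have h₃ : ⟪f' y, (1 / L) • (f' y - f' x)⟫ - ⟪f' x, (1 / L) • (f' y - f' x)⟫
      = 1 / L * ‖f' y - f' x‖ ^ 2 := by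
    rw [← inner_sub_left, real_inner_smul_right, real_inner_self_eq_norm_sq]
  have h₄ : L / 2 * ‖(1 / L) • (f' y - f' x)‖ ^ 2 = 1 / (2 * L) * ‖f' y - f' x‖ ^ 2 := by
    rw [norm_smul, Real.norm_of_nonneg (by positivity)]
    field_simp
  have h₅ : 1 / L * ‖f' y - f' x‖ ^ 2 = 2 * (1 / (2 * L) * ‖f' y - f' x‖ ^ 2) := by
    field_simp
  rw [add_sub_right_comm, inner_add_right] at h₂
  linarith

end Smooth

/-- The key estimate (3.5) in the proof of Proposition 3.1: with `fᵢ` convex and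
`Lᵢ`-smooth, `F = (1/n)∑ᵢ fᵢ` and `L_Q = maxᵢ Lᵢ/(qᵢ n)`, for all `y, x̃`,
`(1/(2 L_Q)) ∑ᵢ qᵢ (1/(n qᵢ))² ‖∇fᵢ(y) − ∇fᵢ(x̃)‖² + ⟪∇F(y), x̃ − y⟫ ≤ F(x̃) − F(y)`. -/
theorem variance_gradient_estimate
    {E : Type*} [NormedAddCommGroup E] [InnerProductSpace ℝ E] [FiniteDimensional ℝ E]
    (n : ℕ) (hn : 1 ≤ n)
    (f : Fin n → E → ℝ) (f' : Fin n → E → E) (L : Fin n → ℝ)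
    (hLpos : ∀ i, 0 < L i)
    (hconv : ∀ i, ConvexOn ℝ Set.univ (f i))
    (hdiff : ∀ i x, HasGradientAt (f i) (f' i x) x)
    (hsmooth : ∀ i, ∀ x y : E, ‖f' i x - f' i y‖ ≤ L i * ‖x - y‖)
    (F' : E → E)
    (hF : ∀ x, HasGradientAt (fun u => (1 / (n : ℝ)) * ∑ i, f i u) (F' x) x)
    (q : Fin n → ℝ) (hq : ∀ i, 0 < q i) (hqsum : ∑ i, q i = 1)
    (LQ : ℝ) (hLQ : LQ = ⨆ i, L i / (q i * n)) :
    ∀ y xt : E,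
      1 / (2 * LQ) * ∑ i, q i * (1 / ((n : ℝ) * q i)) ^ 2 * ‖f' i y - f' i xt‖ ^ 2
          + ⟪F' y, xt - y⟫ ≤
        (1 / (n : ℝ)) * ∑ i, f i xt - (1 / (n : ℝ)) * ∑ i, f i y := by
  intro y xt
  have hn0 : (0 : ℝ) < n := by exact_mod_cast hn
  have hF' : F' y = (1 / (n : ℝ)) • ∑ i, f' i y := by
    refine (hF y).unique ?_
    rw [hasGradientAt_iff_hasFDerivAt]
    have h := (HasFDerivAt.fun_sum (u := Finset.univ)
      (fun i _ => (hdiff i y).hasFDerivAt)).const_mul (1 / (n : ℝ))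
    simpa using h
  have hle (i : Fin n) : L i / (q i * n) ≤ LQ :=
    hLQ ▸ le_ciSup (f := fun i => L i / (q i * n)) (Set.finite_range _).bddAbove i
  rw [hF', real_inner_smul_left, sum_inner, ← mul_sub, ← Finset.sum_sub_distrib,
    Finset.mul_sum, Finset.mul_sum, Finset.mul_sum, ← Finset.sum_add_distrib]
  refine Finset.sum_le_sum fun i _ => ?_
  have hco := (hconv i).norm_sub_gradient_sq_le (hLpos i) (hdiff i) (hsmooth i) y xt
  have hLi := hLpos i
  have hqi := hq i
  have hpos : 0 < L i / (q i * n) := by positivity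
  have hcoef : 1 / (2 * LQ) * (q i * (1 / ((n : ℝ) * q i)) ^ 2) ≤ 1 / n * (1 / (2 * L i)) :=
    calc 1 / (2 * LQ) * (q i * (1 / ((n : ℝ) * q i)) ^ 2)
        ≤ 1 / (2 * (L i / (q i * n))) * (q i * (1 / ((n : ℝ) * q i)) ^ 2) := by
          gcongr
          exact hle i
      _ = 1 / n * (1 / (2 * L i)) := by field_simp
  calc _ = 1 / (2 * LQ) * (q i * (1 / ((n : ℝ) * q i)) ^ 2) * ‖f' i y - f' i xt‖ ^ 2
        + 1 / n * ⟪f' i y, xt - y⟫ := by ring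
    _ ≤ 1 / n * (1 / (2 * L i)) * ‖f' i y - f' i xt‖ ^ 2 + 1 / n * ⟪f' i y, xt - y⟫ := by
        gcongr
    _ = 1 / n * (1 / (2 * L i) * ‖f' i y - f' i xt‖ ^ 2 + ⟪f' i y, xt - y⟫) := by ring
    _ ≤ _ := by gcongr
end

section
/- (Deterministic sequence form of Theorem 3.1.) Let m ≥ 1 be an integer, α₃ ∈ (0,1), L̄ > 0. For s ≥ 1 set α_{2,s} = 2/(s+2) and α_{1,s} = 1 − α₃ − 2/(s+2), and assume α_{1,s} ≥ 0 for s ≥ 1. Let nonnegative reals d_{k,s} (0 ≤ k ≤ m, s ≥ 0), D_{k,s} ≥ 0, and d̃_s ≥ 0 satisfy: d_{0,s} = d_{m,s−1} and D_{0,s} = D_{m,s−1} for all s ≥ 1; m·d̃_s ≤ ∑_{k=1}^m d_{k,s} for all s ≥ 0; and for all s ≥ 1, 1 ≤ k ≤ m, d_{k,s} ≤ α_{1,s} d_{k−1,s} + α₃ d̃_{s−1} + α_{2,s}² L̄ (D_{k−1,s} − D_{k,s}). Then for all s ≥ 1: d̃_s ≤ (4/(s+3)²) [ (1 − α_{2,1})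 d_{m,0}/(α_{2,1}² α₃ m) + (1/(m α_{2,1}²)) ∑_{k=1}^{m−1} d_{k,0} + (L̄/(m α₃)) D_{m,0} ]; in particular d̃_s = O(1/(s+3)²). -/
/-- Summing the inner recursion over one stage, with the interior sum
`∑ k ∈ Icc 1 (m - 1), d k` isolated from the endpoint values `d 0` and `d m`. -/
lemma stage_sum_le {n : ℕ} {d D : ℕ → ℝ} {a b c : ℝ}
    (h : ∀ k < n + 1, d (k + 1) ≤ a * d k + b + c * (D k - D (k + 1))) :
    d (n + 1) + (1 - a) * ∑ k ∈ Finset.Icc 1 n, d k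
      ≤ a * d 0 + (n + 1) * b + c * (D 0 - D (n + 1)) := by
  induction n with
  | zero => simpa using h 0 one_pos
  | succ n ih =>
    have h₁ := ih fun k hk => h k (by omega)
    have h₂ := h (n + 1) (by omega)
    rw [Finset.sum_Icc_succ_top (by omega)]
    push_cast
    linarith

/-- The potential decreasing from stage to stage: four times the weighted sum of the endpoint gap
`x`, the interior gap sum `S` and the Bregman distance `y`. -/
def stagePotential (α L t x S y : ℝ) : ℝ :=
  (t + 3) * (t + 1) * x + α * (t + 3) ^ 2 * S + 4 * L * y

/-- One stage does not increase the potential. -/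
lemma stagePotential_succ_le {α L t x S y x' S' y' : ℝ} (ht : 0 ≤ t) (hα : α ≤ 1 / 3)
    (hx' : 0 ≤ x') (hS' : 0 ≤ S')
    (h : x' + (α + 2 / (t + 3)) * S'
      ≤ (1 - 2 / (t + 3)) * x + α * S + (2 / (t + 3)) ^ 2 * L * (y - y')) :
    stagePotential α L (t + 1) x' S' y' ≤ stagePotential α L t x S y := by
  have h₁ := mul_le_mul_of_nonneg_left h (sq_nonneg (t + 3))
  have e₁ : (t + 3) ^ 2 * (x' + (α + 2 / (t + 3)) * S')
      = (t + 3) ^ 2 * x' + (α * (t + 3) ^ 2 + 2 * (t + 3)) * S' := by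
    field_simp
  have e₂ : (t + 3) ^ 2 * ((1 - 2 / (t + 3)) * x + α * S + (2 / (t + 3)) ^ 2 * L * (y - y'))
      = (t + 3) * (t + 1) * x + α * (t + 3) ^ 2 * S + 4 * L * (y - y') := by
    field_simp
    ring
  rw [e₁, e₂] at h₁
  have h₂ : 0 ≤ (2 * (t + 3) - α * (2 * t + 7)) * S' :=
    mul_nonneg (by nlinarith) hS'
  unfold stagePotential
  linarith

/-- Theorem 3.1 (deterministic sequence form): the exact (error-free) recursion with
`α_{2,s} = 2/(s+2)`, `α_{1,s} = 1 − α₃ − 2/(s+2)` yields the optimal `O(1/(s+3)²)` rate. -/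
theorem asmd_exact_rate
    (m : ℕ) (hm : 1 ≤ m)
    (α₃ : ℝ) (hα₃pos : 0 < α₃) (hα₃lt : α₃ < 1)
    (Lbar : ℝ) (hLbar : 0 < Lbar)
    (hα₁nn : ∀ s : ℕ, 1 ≤ s → 0 ≤ 1 - α₃ - 2 / ((s : ℝ) + 2))
    (d Dd : ℕ → ℕ → ℝ) (dt : ℕ → ℝ)
    (hdnn : ∀ k ≤ m, ∀ s : ℕ, 0 ≤ d k s)
    (hDnn : ∀ k ≤ m, ∀ s : ℕ, 0 ≤ Dd k s)
    (hdtnn : ∀ s : ℕ, 0 ≤ dt s)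
    (hlinkd : ∀ s : ℕ, 1 ≤ s → d 0 s = d m (s - 1))
    (hlinkD : ∀ s : ℕ, 1 ≤ s → Dd 0 s = Dd m (s - 1))
    (hstage : ∀ s : ℕ, (m : ℝ) * dt s ≤ ∑ k ∈ Finset.Icc 1 m, d k s)
    (hrec : ∀ s : ℕ, 1 ≤ s → ∀ k : ℕ, 1 ≤ k → k ≤ m →
      d k s ≤ (1 - α₃ - 2 / ((s : ℝ) + 2)) * d (k - 1) s + α₃ * dt (s - 1)
        + (2 / ((s : ℝ) + 2)) ^ 2 * Lbar * (Dd (k - 1) s - Dd k s)) :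
    ∀ s : ℕ, 1 ≤ s →
      dt s ≤ 4 / ((s : ℝ) + 3) ^ 2 *
          ((1 - (2 : ℝ) / 3) * d m 0 / (((2 : ℝ) / 3) ^ 2 * α₃ * m)
            + 1 / (m * ((2 : ℝ) / 3) ^ 2) * ∑ k ∈ Finset.Icc 1 (m - 1), d k 0
            + Lbar / (m * α₃) * Dd m 0) := by
  obtain ⟨n, rfl⟩ : ∃ n, m = n + 1 := ⟨m - 1, by omega⟩
  simp only [Nat.add_sub_cancel]
  set S : ℕ → ℝ := fun s => ∑ k ∈ Finset.Icc 1 n, d k s with hS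
  have hSnn (s : ℕ) : 0 ≤ S s :=
    Finset.sum_nonneg fun k hk => hdnn k (by have := Finset.mem_Icc.1 hk; omega) s
  have hα₃ : α₃ ≤ 1 / 3 := by
    have := hα₁nn 1 le_rfl
    norm_num at this
    linarith
  have hgap (s : ℕ) : ((n : ℝ) + 1) * dt s ≤ S s + d (n + 1) s := by
    have := hstage s
    rw [Finset.sum_Icc_succ_top (by omega)] at this
    exact_mod_cast this
  let V : ℕ → ℝ := fun s => stagePotential α₃ Lbar s (d (n + 1) s) (S s) (Dd (n + 1) s)
  have hV : Antitone V := by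
    refine antitone_nat_of_succ_le fun s => ?_
    have hsum := stage_sum_le (n := n) (d := fun k => d k (s + 1)) (D := fun k => Dd k (s + 1))
      fun k hk => hrec (s + 1) (by omega) (k + 1) (by omega) (by omega)
    rw [hlinkd (s + 1) (by omega), hlinkD (s + 1) (by omega)] at hsum
    simp only [Nat.add_sub_cancel] at hsum
    have ht : ((s + 1 : ℕ) : ℝ) + 2 = s + 3 := by push_cast; ring
    rw [ht] at hsum
    have hgap' := mul_le_mul_of_nonneg_left (hgap s) hα₃pos.le
    simp only [V, Nat.cast_add, Nat.cast_one]
    refine stagePotential_succ_le s.cast_nonneg hα₃ (hdnn _ le_rfl _) (hSnn _) ?_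
    simp only [hS] at hgap' ⊢
    linarith
  intro s _
  have hlow : α₃ * (s + 3) ^ 2 * (((n : ℝ) + 1) * dt s) ≤ V s := by
    have hs : (0 : ℝ) ≤ s := s.cast_nonneg
    have h₁ := mul_le_mul_of_nonneg_left (hgap s) (by positivity : 0 ≤ α₃ * ((s : ℝ) + 3) ^ 2)
    have h₂ : 0 ≤ ((s : ℝ) + 3) * ((s + 1) - α₃ * (s + 3)) * d (n + 1) s :=
      mul_nonneg (mul_nonneg (by positivity) (by nlinarith)) (hdnn _ le_rfl _)
    have h₃ : 0 ≤ Lbar * Dd (n + 1) s := mul_nonneg hLbar.le (hDnn _ le_rfl _)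
    simp only [V, stagePotential]
    linarith
  have hbound := hlow.trans (hV s.zero_le)
  simp only [V, stagePotential, Nat.cast_zero] at hbound
  have hpos : 0 < α₃ * ((s : ℝ) + 3) ^ 2 * ((n : ℝ) + 1) := by positivity
  rw [← mul_assoc, ← le_div_iff₀' hpos] at hbound
  refine hbound.trans_eq ?_
  push_cast
  field_simp
  ring
end
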